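/- Let p be a prime, ε ∈ ℤ_p^×, and m ≥ 3 an integer. Let T₁, …, T_u be pairwise non-ℤ-equivalent positive definite half-integral ternary forms, mutually ℤ_q-equivalent at every prime q, with Gram matrices ℤ_p-equivalent to H ⊕ [p^m ε]. Let S₁, …, S_v be pairwise non-ℤ-equivalent positive definite half-integral ternary forms with Gram matrices ℤ_p-equivalent to H ⊕ [p^{m+1}ε] and ℤ_q-equivalent to p·Gram(T₁) at every prime q ≠ p. Assume: (i) for every j and every subgroup N ≤ ℤ³ of index p on which f_{S_j} takes values in pℤ, the form (1/p)·f_{S_j}|N is ℤ-equivalent to some T_i; (ii) for every i and every subgroup M ≤ ℤ³ with ℤ³/M ≅ ℤ/pℤ ⊕ ℤ/pℤ on which f_{T_i} takes values in pℤ and with M ≠ Λ_p(T_i) := {x ∈ ℤ³ : f_{T_i}(x+z) ≡ f_{T_i}(z) (mod p) for all z}, the Gram matrix of f_{T_i}|M is ℤ-equivalent to p·Gram(S_j) for some j. Set 𝓝 := (r(T_i^p, S_j)/o(S_j)). Then for every positive integer n not divisible by p: (a) r(pn, T_i) = Σ_{j=1}^{v} (r(T_i^p, S_j)/o(S_j))·r(n,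 S_j) for each i; and (b) if moreover rank(𝓝) = u, then (r(n, T_i)/o(T_i))_{i=1}^{u} = (𝓝𝓝ᵗ)^{-1}·𝓝·(r(pn, S_j)/o(S_j))_{j=1}^{v}. -/

import Mathlib

open Matrix

noncomputable section

/-- The image of an integral matrix in the rational matrices. -/
def intMap (X : Matrix (Fin 3) (Fin 3) ℤ) : Matrix (Fin 3) (Fin 3) ℚ :=
  X.map fun a => (a : ℚ)

/-- The value of the quadratic form with Gram matrix `A` at an integral vector `x`. -/
def qf (A : Matrix (Fin 3) (Fin 3) ℚ) (x : Fin 3 → ℤ) : ℚ :=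
  (fun i => (x i : ℚ)) ⬝ᵥ A.mulVec fun i => (x i : ℚ)

/-- A rational symmetric matrix is half-integral: integral diagonal, off-diagonal in (1/2)ℤ. -/
def HalfIntegral (A : Matrix (Fin 3) (Fin 3) ℚ) : Prop :=
  (∀ i, ∃ n : ℤ, A i i = n) ∧ ∀ i j, ∃ n : ℤ, 2 * A i j = n

/-- `A` is symmetric and positive definite. -/
def PosDef3 (A : Matrix (Fin 3) (Fin 3) ℚ) : Prop :=
  A.IsSymm ∧ ∀ x : Fin 3 → ℚ, x ≠ 0 → 0 < x ⬝ᵥ A.mulVec x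

/-- `r(K, L)`: the number of representations of the form with Gram matrix `A` by the form
with Gram matrix `B`. -/
def repNum (A B : Matrix (Fin 3) (Fin 3) ℚ) : ℕ :=
  Nat.card {X : Matrix (Fin 3) (Fin 3) ℤ // (intMap X)ᵀ * B * intMap X = A}

/-- `o(L)`: the number of integral automorphs of the form with Gram matrix `A`. -/
def autNum (A : Matrix (Fin 3) (Fin 3) ℚ) : ℕ :=
  Nat.card {X : Matrix (Fin 3) (Fin 3) ℤ // IsUnit X.det ∧ (intMap X)ᵀ * A * intMap X = A}

/-- `r(n, f)`: the number of representations of the integer `n` by the form with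
Gram matrix `A`. -/
def rEval (A : Matrix (Fin 3) (Fin 3) ℚ) (n : ℤ) : ℕ :=
  Nat.card {x : Fin 3 → ℤ // qf A x = (n : ℚ)}

/-- ℤ-equivalence of Gram matrices. -/
def ZEquiv (A B : Matrix (Fin 3) (Fin 3) ℚ) : Prop :=
  ∃ X : Matrix (Fin 3) (Fin 3) ℤ, IsUnit X.det ∧ (intMap X)ᵀ * A * intMap X = B

/-- The Watson set `Λ_p(A) = {x ∈ ℤ³ : f_A(x + z) ≡ f_A(z) (mod p) for all z ∈ ℤ³}`. -/
def LamSet (p : ℕ) (A : Matrix (Fin 3) (Fin 3) ℚ) : Set (Fin 3 → ℤ) :=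
  {x | ∀ z : Fin 3 → ℤ, ∃ k : ℤ, qf A (x + z) - qf A z = (p : ℚ) * k}

/-- ℤ_q-equivalence of rational Gram matrices (inside ℚ_q). -/
def ZqEquiv (q : ℕ) [Fact q.Prime] (A B : Matrix (Fin 3) (Fin 3) ℚ) : Prop :=
  ∃ X : Matrix (Fin 3) (Fin 3) ℤ_[q], IsUnit X.det ∧
    (X.map fun a => (a : ℚ_[q]))ᵀ * A.map (fun a => (a : ℚ_[q])) * X.map (fun a => (a : ℚ_[q]))
      = B.map fun a => (a : ℚ_[q])

/-- ℤ_q-equivalence of a rational Gram matrix to a q-adic target matrix. -/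
def ZpEquivTo (q : ℕ) [Fact q.Prime] (A : Matrix (Fin 3) (Fin 3) ℚ)
    (B : Matrix (Fin 3) (Fin 3) ℚ_[q]) : Prop :=
  ∃ X : Matrix (Fin 3) (Fin 3) ℤ_[q], IsUnit X.det ∧
    (X.map fun a => (a : ℚ_[q]))ᵀ * A.map (fun a => (a : ℚ_[q])) * X.map (fun a => (a : ℚ_[q])) = B

/-- The block diagonal matrix `H ⊕ [c]` with `H = [[0,1/2],[1/2,0]]`. -/
def Hblock (q : ℕ) [Fact q.Prime] (c : ℚ_[q]) : Matrix (Fin 3) (Fin 3) ℚ_[q] :=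
  !![0, 1/2, 0; 1/2, 0, 0; 0, 0, c]

theorem mulVec_dotProduct_mulVec_mulVec {R : Type*} [CommRing R] (M A : Matrix (Fin 3) (Fin 3) R)
    (v : Fin 3 → R) : M.mulVec v ⬝ᵥ A.mulVec (M.mulVec v) = v ⬝ᵥ (Mᵀ * A * M).mulVec v := by
  rw [← Matrix.mulVec_mulVec, ← Matrix.mulVec_mulVec, Matrix.dotProduct_mulVec _ Mᵀ,
    Matrix.vecMul_transpose]

theorem qf_mulVec (B : Matrix (Fin 3) (Fin 3) ℚ) (X : Matrix (Fin 3) (Fin 3) ℤ)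
    (x : Fin 3 → ℤ) : qf B (X.mulVec x) = qf ((intMap X)ᵀ * B * intMap X) x := by
  have h : (fun i => ((X.mulVec x i : ℤ) : ℚ)) = (intMap X).mulVec fun i => (x i : ℚ) := by
    ext i
    simp [Matrix.mulVec, dotProduct, intMap]
  unfold qf
  rw [h, mulVec_dotProduct_mulVec_mulVec]

theorem qf_smul_matrix (c : ℚ) (B : Matrix (Fin 3) (Fin 3) ℚ) (x : Fin 3 → ℤ) :
    qf (c • B) x = c * qf B x := by
  simp [qf, Matrix.smul_mulVec]

theorem qf_smul (B : Matrix (Fin 3) (Fin 3) ℚ) (k : ℤ) (x : Fin 3 → ℤ) :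
    qf B (k • x) = (k : ℚ) ^ 2 * qf B x := by
  have h : (fun i => (((k • x) i : ℤ) : ℚ)) = (k : ℚ) • fun i => (x i : ℚ) := by
    ext i
    simp
  unfold qf
  rw [h, Matrix.mulVec_smul, dotProduct_smul, smul_dotProduct, smul_eq_mul, smul_eq_mul]
  ring

theorem HalfIntegral.exists_qf_eq {A : Matrix (Fin 3) (Fin 3) ℚ} (hs : A.IsSymm)
    (h : HalfIntegral A) (x : Fin 3 → ℤ) : ∃ k : ℤ, qf A x = k := by
  obtain ⟨h1, h2⟩ := h
  choose d hd using h1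
  choose e he using h2
  refine ⟨d 0 * x 0 ^ 2 + d 1 * x 1 ^ 2 + d 2 * x 2 ^ 2 + e 0 1 * x 0 * x 1 + e 0 2 * x 0 * x 2
    + e 1 2 * x 1 * x 2, ?_⟩
  push_cast
  rw [← hd, ← hd, ← hd, ← he, ← he, ← he]
  simp only [qf, Matrix.mulVec, dotProduct, Fin.sum_univ_three]
  rw [hs.apply 0 1, hs.apply 0 2, hs.apply 1 2]
  ring

theorem intMap_mul (X Y : Matrix (Fin 3) (Fin 3) ℤ) : intMap (X * Y) = intMap X * intMap Y :=
  Matrix.map_mul (f := Int.castRingHom ℚ)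

theorem intMap_smul (k : ℤ) (X : Matrix (Fin 3) (Fin 3) ℤ) :
    intMap (k • X) = (k : ℚ) • intMap X := by
  ext i j
  exact Int.cast_mul k (X i j)

theorem intMap_one : intMap 1 = 1 := by
  ext i j
  simp [intMap, Matrix.one_apply]

theorem det_intMap (X : Matrix (Fin 3) (Fin 3) ℤ) : (intMap X).det = (X.det : ℚ) :=
  ((Int.castRingHom ℚ).map_det X).symm

theorem congr_mul (A : Matrix (Fin 3) (Fin 3) ℚ) (X Y : Matrix (Fin 3) (Fin 3) ℤ) :
    (intMap (X * Y))ᵀ * A * intMap (X * Y)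
      = (intMap Y)ᵀ * ((intMap X)ᵀ * A * intMap X) * intMap Y := by
  rw [intMap_mul, Matrix.transpose_mul]
  simp only [Matrix.mul_assoc]

theorem PosDef3.det_ne_zero {A : Matrix (Fin 3) (Fin 3) ℚ} (h : PosDef3 A) : A.det ≠ 0 := by
  intro h0
  obtain ⟨v, hv, hv0⟩ := Matrix.exists_mulVec_eq_zero_iff.mpr h0
  have := h.2 v hv
  rw [hv0] at this
  simp at this

theorem PosDef3.dotProduct_sq_le {A : Matrix (Fin 3) (Fin 3) ℚ} (h : PosDef3 A)
    (w x : Fin 3 → ℚ) :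
    (w ⬝ᵥ A.mulVec x) ^ 2 ≤ (w ⬝ᵥ A.mulVec w) * (x ⬝ᵥ A.mulVec x) := by
  have hsymm : x ⬝ᵥ A.mulVec w = w ⬝ᵥ A.mulVec x := by
    rw [Matrix.dotProduct_mulVec, ← Matrix.mulVec_transpose, h.1.eq, dotProduct_comm]
  by_cases hw : w = 0
  · simp [hw]
  have hw' := h.2 w hw
  set a := w ⬝ᵥ A.mulVec w
  set t := w ⬝ᵥ A.mulVec x
  set b := x ⬝ᵥ A.mulVec x
  have key : 0 ≤ (a • x - t • w) ⬝ᵥ A.mulVec (a • x - t • w) := by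
    by_cases hz : a • x - t • w = 0
    · simp [hz]
    · exact (h.2 _ hz).le
  have hexp : (a • x - t • w) ⬝ᵥ A.mulVec (a • x - t • w) = a * (a * b - t ^ 2) := by
    simp only [Matrix.mulVec_sub, Matrix.mulVec_smul, sub_dotProduct, dotProduct_sub,
      smul_dotProduct, dotProduct_smul, smul_eq_mul, hsymm]
    simp only [← show a = w ⬝ᵥ A.mulVec w from rfl, ← show t = w ⬝ᵥ A.mulVec x from rfl,
      ← show b = x ⬝ᵥ A.mulVec x from rfl]
    ring
  rw [hexp] at key
  have := nonneg_of_mul_nonneg_right key hw'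
  linarith

theorem PosDef3.finite_qf_eq {A : Matrix (Fin 3) (Fin 3) ℚ} (h : PosDef3 A) (n : ℚ) :
    {x : Fin 3 → ℤ | qf A x = n}.Finite := by
  have hcoord : ∀ i : Fin 3, ∃ C : ℚ, ∀ x : Fin 3 → ℤ, qf A x = n → (x i : ℚ) ^ 2 ≤ C := by
    intro i
    refine ⟨(A⁻¹.mulVec (Pi.single i 1) ⬝ᵥ A.mulVec (A⁻¹.mulVec (Pi.single i 1))) * n, ?_⟩
    intro x hx
    have hcs := h.dotProduct_sq_le (A⁻¹.mulVec (Pi.single i 1)) fun i => (x i : ℚ)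
    have hx' : (fun i => (x i : ℚ)) ⬝ᵥ A.mulVec (fun i => (x i : ℚ)) = n := hx
    rw [hx'] at hcs
    convert hcs using 2
    rw [Matrix.dotProduct_mulVec, ← Matrix.mulVec_transpose, h.1.eq, Matrix.mulVec_mulVec,
      Matrix.mul_nonsing_inv _ (isUnit_iff_ne_zero.mpr h.det_ne_zero),
      Matrix.one_mulVec, single_one_dotProduct]
  choose C hC using hcoord
  refine (Set.Finite.pi' (ι := Fin 3) (t := fun i => Set.Icc (-(⌈C i⌉)) ⌈C i⌉)
    fun i => Set.finite_Icc _ _).subset ?_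
  intro x hx i
  have h1 := (hC i x hx).trans (Int.le_ceil (C i))
  have h2 : x i ^ 2 ≤ ⌈C i⌉ := by exact_mod_cast h1
  constructor <;> nlinarith

theorem PosDef3.finite_rep {B : Matrix (Fin 3) (Fin 3) ℚ} (h : PosDef3 B)
    (A : Matrix (Fin 3) (Fin 3) ℚ) :
    {X : Matrix (Fin 3) (Fin 3) ℤ | (intMap X)ᵀ * B * intMap X = A}.Finite := by
  have hfin := Set.Finite.pi' (ι := Fin 3) fun k => h.finite_qf_eq (qf A (Pi.single k 1))
  refine Set.Finite.of_finite_image (f := Matrix.transpose) (hfin.subset ?_)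
    Matrix.transpose_injective.injOn
  rintro _ ⟨X, hX, rfl⟩ k
  have hX' : (intMap X)ᵀ * B * intMap X = A := hX
  have := qf_mulVec B X (Pi.single k 1)
  rw [hX'] at this
  rwa [Matrix.mulVec_single_one] at this

theorem PosDef3.autNum_ne_zero {A : Matrix (Fin 3) (Fin 3) ℚ} (h : PosDef3 A) :
    autNum A ≠ 0 := by
  have hfin : Finite {X : Matrix (Fin 3) (Fin 3) ℤ //
      IsUnit X.det ∧ (intMap X)ᵀ * A * intMap X = A} :=
    ((h.finite_rep A).subset fun X hX => hX.2).to_subtype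
  have : Nonempty {X : Matrix (Fin 3) (Fin 3) ℤ //
      IsUnit X.det ∧ (intMap X)ᵀ * A * intMap X = A} :=
    ⟨⟨1, by simp, by simp [intMap_one]⟩⟩
  exact Nat.card_pos.ne'

/-- A weighted double count: each target point `x` is related to exactly `c i₀` elements of a
single family `R i₀`, and each `X ∈ R i` is related to as many points as `V i` has. -/
theorem card_eq_sum_of_fibers {ι : Type*} [Fintype ι] {α : Type*} [Finite α]
    {R V : ι → Type*} [∀ i, Finite (R i)] (c : ι → ℕ) (hc : ∀ i, c i ≠ 0)
    (Q : ∀ i, R i → α → Prop)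
    (hV : ∀ i X, Nat.card {x // Q i X x} = Nat.card (V i))
    (hR : ∀ x, ∃ i, Nat.card {X // Q i X x} = c i ∧ ∀ j, j ≠ i → ∀ X, ¬ Q j X x) :
    (Nat.card α : ℚ) = ∑ i, ((Nat.card (R i) : ℚ) / c i) * Nat.card (V i) := by
  classical
  have := Fintype.ofFinite α
  have := fun i => Fintype.ofFinite (R i)
  have hdouble : ∀ i, Nat.card (R i) * Nat.card (V i) = ∑ x : α, Nat.card {X // Q i X x} := by
    intro i
    have h := Finset.sum_card_bipartiteAbove_eq_sum_card_bipartiteBelow (Q i)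
      (s := Finset.univ) (t := Finset.univ)
    simp only [Finset.bipartiteAbove, Finset.bipartiteBelow, ← Fintype.card_subtype,
      ← Nat.card_eq_fintype_card, hV] at h
    rw [← h]
    simp [Nat.card_eq_fintype_card]
  have hone : ∀ x : α, ∑ i, (Nat.card {X // Q i X x} : ℚ) / c i = 1 := by
    intro x
    obtain ⟨i, hi, hne⟩ := hR x
    rw [Finset.sum_eq_single i]
    · rw [hi, div_self]
      exact_mod_cast hc i
    · intro j _ hj
      have : IsEmpty {X // Q j X x} := ⟨fun X => hne j hj X.1 X.2⟩
      simp
    · simp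
  calc (Nat.card α : ℚ) = ∑ x : α, (1 : ℚ) := by simp [Nat.card_eq_fintype_card]
    _ = ∑ x : α, ∑ i, (Nat.card {X // Q i X x} : ℚ) / c i := by simp only [hone]
    _ = ∑ i, (∑ x : α, (Nat.card {X // Q i X x} : ℚ)) / c i := by
        rw [Finset.sum_comm]
        simp only [Finset.sum_div]
    _ = _ := by
        refine Finset.sum_congr rfl fun i _ => ?_
        rw [div_mul_eq_mul_div]
        congr 1
        exact_mod_cast (hdouble i).symm

theorem exists_matrix_of_finiteIndex (N : AddSubgroup (Fin 3 → ℤ)) (hN : N.index ≠ 0) :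
    ∃ Y : Matrix (Fin 3) (Fin 3) ℤ, ∀ x, x ∈ N ↔ ∃ c, x = Y.mulVec c := by
  have hfi : N.FiniteIndex := ⟨hN⟩
  have hrank : Module.finrank ℤ (AddSubgroup.toIntSubmodule N) = 3 := by
    have := AddSubgroup.finrank_eq_of_finiteIndex N
    rwa [Module.finrank_fin_fun] at this
  let b := Module.finBasisOfFinrankEq ℤ (AddSubgroup.toIntSubmodule N) hrank
  have hb : ∀ c : Fin 3 → ℤ, (Matrix.of fun i j => (b j : Fin 3 → ℤ) i).mulVec c
      = ((∑ j, c j • b j : AddSubgroup.toIntSubmodule N) : Fin 3 → ℤ) := by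
    intro c
    ext i
    simp [Matrix.mulVec, dotProduct, mul_comm]
  refine ⟨Matrix.of fun i j => (b j : Fin 3 → ℤ) i, fun x => ⟨fun hx => ?_, ?_⟩⟩
  · refine ⟨b.repr ⟨x, hx⟩, ?_⟩
    rw [hb, b.sum_repr]
  · rintro ⟨c, rfl⟩
    rw [hb]
    exact (∑ j, c j • b j : AddSubgroup.toIntSubmodule N).2

theorem exists_eq_mul_of_forall_mulVec {X Y : Matrix (Fin 3) (Fin 3) ℤ}
    (h : ∀ c, ∃ d, X.mulVec c = Y.mulVec d) : ∃ Z, X = Y * Z := by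
  choose d hd using fun k => h (Pi.single k 1)
  refine ⟨Matrix.of fun i k => d k i, ?_⟩
  ext i k
  have := congrFun (hd k) i
  rw [Matrix.mulVec_single_one] at this
  simpa [Matrix.mul_apply, Matrix.mulVec, dotProduct] using this

theorem exists_reduction {p : ℕ} [Fact p.Prime] {A : Matrix (Fin 3) (Fin 3) ℚ} {k : ℕ}
    (hk : 2 ≤ k) (ε : ℤ_[p]ˣ)
    (h : ZpEquivTo p A (Hblock p ((p : ℚ_[p]) ^ k * ((ε : ℤ_[p]) : ℚ_[p])))) :
    ∃ φ : (Fin 3 → ℤ) →+ (Fin 3 → ZMod p), Function.Surjective φ ∧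
      ∀ (x : Fin 3 → ℤ) (n : ℤ), qf A x = n →
        ((p : ℤ) ∣ n ↔ φ x 0 * φ x 1 = 0) ∧
        (φ x 0 = 0 → φ x 1 = 0 → (p : ℤ) ^ 2 ∣ n) := by
  obtain ⟨X, hX, hXA⟩ := h
  set L := X⁻¹ with hL
  have hXL : X * L = 1 := Matrix.mul_nonsing_inv _ hX
  have hLX : L * X = 1 := Matrix.nonsing_inv_mul _ hX
  let ι : ℤ_[p] →+* ℚ_[p] := PadicInt.Coe.ringHom
  let C : (Fin 3 → ℤ) →+ (Fin 3 → ℤ_[p]) := (Int.castAddHom ℤ_[p]).compLeft (Fin 3)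
  let φ : (Fin 3 → ℤ) →+ (Fin 3 → ZMod p) :=
    ((PadicInt.toZMod (p := p)).toAddMonoidHom.compLeft (Fin 3)).comp
      ((Matrix.mulVecLin L).toAddMonoidHom.comp C)
  have hφ : ∀ x i, φ x i = PadicInt.toZMod (L.mulVec (fun j => (x j : ℤ_[p])) i) :=
    fun x i => rfl
  refine ⟨φ, ?_, ?_⟩
  · intro y
    choose w hw using fun i => ZMod.intCast_surjective
      ((X.map (PadicInt.toZMod (p := p))).mulVec y i)
    refine ⟨w, ?_⟩
    have h1 : φ w = (L.map (PadicInt.toZMod (p := p))).mulVec fun j => (w j : ZMod p) := by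
      ext i
      rw [hφ]
      simp [Matrix.mulVec, dotProduct]
    rw [h1, funext hw, Matrix.mulVec_mulVec, ← Matrix.map_mul, hLX,
      Matrix.map_one _ (map_zero _) (map_one _), Matrix.one_mulVec]
  · intro x n hn
    set l := L.mulVec (fun j => (x j : ℤ_[p])) with hl
    have hxl : (fun j => (x j : ℤ_[p])) = X.mulVec l := by
      rw [hl, Matrix.mulVec_mulVec, hXL, Matrix.one_mulVec]
    have hxl' : (fun j => (x j : ℚ_[p])) = (X.map ι).mulVec fun j => ι (l j) := by
      ext i
      have := congrArg ι (congrFun hxl i)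
      simpa [Matrix.mulVec, dotProduct] using this
    have hq : ((n : ℤ_[p]) : ℚ_[p])
        = ((l 0 * l 1 + (p : ℤ_[p]) ^ k * ε * l 2 ^ 2 : ℤ_[p]) : ℚ_[p]) := by
      have h1 : ((qf A x : ℚ) : ℚ_[p]) = (fun j => (x j : ℚ_[p])) ⬝ᵥ
          (A.map (fun a => (a : ℚ_[p]))).mulVec fun j => (x j : ℚ_[p]) := by
        simp [qf, Matrix.mulVec, dotProduct]
      rw [hn, hxl', mulVec_dotProduct_mulVec_mulVec] at h1
      have h2 : (X.map ι)ᵀ * A.map (fun a => (a : ℚ_[p])) * X.map ι = _ := hXA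
      rw [h2] at h1
      have h3 : (((n : ℤ) : ℚ) : ℚ_[p]) = ((n : ℤ_[p]) : ℚ_[p]) := by simp
      rw [← h3, h1]
      simp only [Hblock, Matrix.mulVec, dotProduct, Fin.sum_univ_three]
      simp only [Matrix.of_apply, Matrix.cons_val]
      simp only [show ∀ a, ι a = (a : ℚ_[p]) from fun a => rfl, PadicInt.coe_add,
        PadicInt.coe_mul, PadicInt.coe_pow, PadicInt.coe_natCast]
      ring
    have hz : (n : ℤ_[p]) = l 0 * l 1 + (p : ℤ_[p]) ^ k * ε * l 2 ^ 2 := Subtype.ext hq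
    have hdvd : ∀ a : ℤ_[p], PadicInt.toZMod a = 0 ↔ (p : ℤ_[p]) ∣ a := by
      intro a
      rw [← RingHom.mem_ker, PadicInt.ker_toZMod, PadicInt.maximalIdeal_eq_span_p,
        Ideal.mem_span_singleton]
    have hk2 : (p : ℤ_[p]) ^ 2 ∣ (p : ℤ_[p]) ^ k * ε * l 2 ^ 2 :=
      ((pow_dvd_pow _ hk).mul_right _).mul_right _
    have hk1 : (p : ℤ_[p]) ∣ (p : ℤ_[p]) ^ k * ε * l 2 ^ 2 :=
      (dvd_pow_self _ two_ne_zero).trans hk2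
    rw [hφ, hφ, ← hl]
    constructor
    · rw [← map_mul, hdvd, ← pow_one (p : ℤ), ← PadicInt.pow_p_dvd_int_iff, pow_one, hz]
      exact dvd_add_left hk1
    · rw [hdvd, hdvd, ← PadicInt.pow_p_dvd_int_iff, hz]
      intro h0 h1
      refine dvd_add ?_ hk2
      rw [pow_two]
      exact mul_dvd_mul h0 h1

theorem ZpEquivTo.norm_det {q : ℕ} [Fact q.Prime] {A : Matrix (Fin 3) (Fin 3) ℚ}
    {B : Matrix (Fin 3) (Fin 3) ℚ_[q]}
    (h : ZpEquivTo q A B) : ‖((A.det : ℚ) : ℚ_[q])‖ = ‖B.det‖ := by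
  obtain ⟨X, hX, hXA⟩ := h
  have h1 := congrArg (fun M => ‖M.det‖) hXA
  have hX' : ‖(X.map fun a => (a : ℚ_[q])).det‖ = 1 := by
    have : (X.map fun a => (a : ℚ_[q])).det = ((X.det : ℤ_[q]) : ℚ_[q]) :=
      ((PadicInt.Coe.ringHom (p := q)).map_det X).symm
    rw [this, ← PadicInt.norm_def]
    exact PadicInt.isUnit_iff.mp hX
  have hc : (A.map fun a => (a : ℚ_[q])).det = ((A.det : ℚ) : ℚ_[q]) :=
    ((Rat.castHom ℚ_[q]).map_det A).symm
  simpa [Matrix.det_mul, hX', hc] using h1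

theorem ZqEquiv.norm_det {q : ℕ} [Fact q.Prime] {A B : Matrix (Fin 3) (Fin 3) ℚ}
    (h : ZqEquiv q A B) : ‖((A.det : ℚ) : ℚ_[q])‖ = ‖((B.det : ℚ) : ℚ_[q])‖ := by
  rw [ZpEquivTo.norm_det (B := B.map fun a => (a : ℚ_[q])) h]
  exact congrArg _ ((Rat.castHom ℚ_[q]).map_det B).symm

theorem mul_left_cancel_of_det_ne_zero {X Y Z : Matrix (Fin 3) (Fin 3) ℤ} (hX : X.det ≠ 0)
    (h : X * Y = X * Z) : Y = Z := by
  have h' := congrArg (X.adjugate * ·) h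
  simp only [← Matrix.mul_assoc, Matrix.adjugate_mul, Matrix.smul_mul, Matrix.one_mul] at h'
  exact smul_right_injective _ hX h'

theorem mul_right_cancel_of_det_ne_zero {X Y Z : Matrix (Fin 3) (Fin 3) ℤ} (hX : X.det ≠ 0)
    (h : Y * X = Z * X) : Y = Z := by
  have h' := congrArg (· * X.adjugate) h
  simp only [Matrix.mul_assoc, Matrix.mul_adjugate, Matrix.mul_smul, Matrix.mul_one] at h'
  exact smul_right_injective _ hX h'

theorem congr_injective {X : Matrix (Fin 3) (Fin 3) ℤ} (hX : X.det ≠ 0)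
    {A B : Matrix (Fin 3) (Fin 3) ℚ}
    (h : (intMap X)ᵀ * A * intMap X = (intMap X)ᵀ * B * intMap X) : A = B := by
  have hu : IsUnit (intMap X) := by
    rw [Matrix.isUnit_iff_isUnit_det, det_intMap, isUnit_iff_ne_zero]
    exact_mod_cast hX
  have hut : IsUnit (intMap X)ᵀ := by
    rw [Matrix.isUnit_iff_isUnit_det, Matrix.det_transpose, det_intMap, isUnit_iff_ne_zero]
    exact_mod_cast hX
  exact hut.mul_left_cancel (hu.mul_right_cancel h)

theorem det_eq_of_rep {p : ℕ} (hp : p.Prime) {S T : Matrix (Fin 3) (Fin 3) ℚ} (hS : S.det ≠ 0)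
    (hST : ∀ q : ℕ, ∀ _ : Fact q.Prime,
      ‖((S.det : ℚ) : ℚ_[q])‖ = ‖(((p : ℚ) * T.det : ℚ) : ℚ_[q])‖)
    {X : Matrix (Fin 3) (Fin 3) ℤ} (hX : (intMap X)ᵀ * S * intMap X = (p : ℚ) • T) :
    ∃ d : ℤ, IsUnit d ∧ X.det = p * d := by
  have hdet : (X.det : ℚ) ^ 2 * S.det = (p : ℚ) ^ 2 * (p * T.det) := by
    have := congrArg Matrix.det hX
    rw [Matrix.det_mul, Matrix.det_mul, Matrix.det_transpose, det_intMap, Matrix.det_smul,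
      Fintype.card_fin] at this
    linear_combination this
  have hnorm : ∀ q : ℕ, ∀ _ : Fact q.Prime, ‖((X.det : ℤ) : ℚ_[q])‖ = ‖((p : ℤ) : ℚ_[q])‖ := by
    intro q hq
    have h1 := congrArg (fun a : ℚ => ‖(a : ℚ_[q])‖) hdet
    simp only [Rat.cast_mul, Rat.cast_pow, norm_mul, norm_pow, Rat.cast_intCast,
      Rat.cast_natCast] at h1
    have h2 := hST q hq
    simp only [Rat.cast_mul, norm_mul, Rat.cast_natCast] at h2
    rw [← h2] at h1
    have hS' : ‖((S.det : ℚ) : ℚ_[q])‖ ≠ 0 := by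
      rw [norm_ne_zero_iff]
      exact_mod_cast hS
    have h3 := mul_right_cancel₀ hS' h1
    rw [Int.cast_natCast]
    exact (pow_left_inj₀ (norm_nonneg _) (norm_nonneg _) two_ne_zero).mp h3
  have hfp : Fact p.Prime := ⟨hp⟩
  obtain ⟨d, hd⟩ : (p : ℤ) ∣ X.det := by
    rw [← Padic.norm_intCast_lt_one_iff, hnorm p hfp, Padic.norm_intCast_lt_one_iff]
  refine ⟨d, ?_, hd⟩
  rw [Int.isUnit_iff_natAbs_eq, Nat.eq_one_iff_not_exists_prime_dvd]
  intro q hq hqd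
  have hfq : Fact q.Prime := ⟨hq⟩
  have h1 := hnorm q hfq
  have h2 : ‖((d : ℤ) : ℚ_[q])‖ < 1 := by
    rw [Padic.norm_intCast_lt_one_iff]
    exact Int.natCast_dvd.mpr hqd
  have hp0 : ‖((p : ℤ) : ℚ_[q])‖ ≠ 0 := by
    rw [norm_ne_zero_iff]
    exact_mod_cast hp.ne_zero
  rw [hd, Int.cast_mul, norm_mul] at h1
  have := mul_left_cancel₀ hp0 (h1.trans (mul_one _).symm)
  linarith

/-- If `p ∥ S(x)` then `x` lies in a sublattice of index `p` on which `S` takes values in `pℤ`,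
and this sublattice contains every lattice through `x` with that property. -/
theorem exists_index_sublattice {p : ℕ} [Fact p.Prime] {S : Matrix (Fin 3) (Fin 3) ℚ}
    (hSint : ∀ x, ∃ k : ℤ, qf S x = k)
    {φ : (Fin 3 → ℤ) →+ (Fin 3 → ZMod p)} (hφ : Function.Surjective φ)
    (hφS : ∀ (x : Fin 3 → ℤ) (n : ℤ), qf S x = n →
        ((p : ℤ) ∣ n ↔ φ x 0 * φ x 1 = 0) ∧
        (φ x 0 = 0 → φ x 1 = 0 → (p : ℤ) ^ 2 ∣ n))
    {x : Fin 3 → ℤ} {n : ℤ} (hx : qf S x = ((p * n : ℤ) : ℚ)) (hn : ¬ (p : ℤ) ∣ n) :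
    ∃ N : AddSubgroup (Fin 3 → ℤ), N.index = p ∧ x ∈ N ∧
      (∀ y ∈ N, ∃ k : ℤ, qf S y = (p : ℚ) * k) ∧
      ∀ X : Matrix (Fin 3) (Fin 3) ℤ, (∀ w, ∃ k : ℤ, qf S (X.mulVec w) = (p : ℚ) * k) →
        (∃ w, X.mulVec w = x) → ∀ w, X.mulVec w ∈ N := by
  have hp0 : (p : ℤ) ≠ 0 := by exact_mod_cast (Fact.out : p.Prime).ne_zero
  obtain ⟨a, b, ha, hb, hab⟩ : ∃ a b : Fin 3, φ x a = 0 ∧ φ x b ≠ 0 ∧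
      ∀ y, φ y 0 * φ y 1 = 0 ↔ φ y a * φ y b = 0 := by
    obtain ⟨h1, h2⟩ := hφS x _ hx
    have hnot : ¬ (φ x 0 = 0 ∧ φ x 1 = 0) := fun h => by
      have := h2 h.1 h.2
      rw [pow_two] at this
      exact hn (Int.dvd_of_mul_dvd_mul_left hp0 this)
    rcases mul_eq_zero.mp (h1.mp (dvd_mul_right _ _)) with h | h
    · exact ⟨0, 1, h, fun h' => hnot ⟨h, h'⟩, fun y => Iff.rfl⟩
    · exact ⟨1, 0, h, fun h' => hnot ⟨h', h⟩, fun y => by rw [mul_comm]⟩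
  have hdvd : ∀ y, (∃ k : ℤ, qf S y = (p : ℚ) * k) ↔ φ y a * φ y b = 0 := by
    intro y
    obtain ⟨k, hk⟩ := hSint y
    rw [← hab, ← (hφS y k hk).1, hk]
    constructor
    · rintro ⟨l, hl⟩
      exact ⟨l, by exact_mod_cast hl⟩
    · rintro ⟨l, hl⟩
      exact ⟨l, by exact_mod_cast hl⟩
  let g : (Fin 3 → ℤ) →+ ZMod p := (Pi.evalAddMonoidHom (fun _ => ZMod p) a).comp φ
  have hg : Function.Surjective g := fun c => by
    obtain ⟨y, hy⟩ := hφ fun _ => c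
    exact ⟨y, congrFun hy a⟩
  refine ⟨g.ker, ?_, ha, ?_, ?_⟩
  · rw [AddSubgroup.index_ker, AddMonoidHom.range_eq_top.mpr hg, AddSubgroup.card_top,
      Nat.card_zmod]
  · intro y hy
    have hy' : φ y a = 0 := hy
    rw [hdvd, hy', zero_mul]
  · rintro X hX ⟨w₀, hw₀⟩ w
    by_contra hw
    have hwa : φ (X.mulVec w) a ≠ 0 := hw
    have hwb : φ (X.mulVec w) b = 0 :=
      (mul_eq_zero.mp ((hdvd _).mp (hX w))).resolve_left hwa
    have := (hdvd _).mp (hX (w + w₀))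
    rw [Matrix.mulVec_add, hw₀, map_add, Pi.add_apply, Pi.add_apply, ha, hwb, add_zero,
      zero_add] at this
    exact mul_ne_zero hwa hb this

theorem isUnit_det_of_mul {p : ℕ} (hp : p ≠ 0) {X Y Z : Matrix (Fin 3) (Fin 3) ℤ}
    (hX : ∃ d : ℤ, IsUnit d ∧ X.det = p * d) (hY : ∃ d : ℤ, IsUnit d ∧ Y.det = p * d)
    (h : X.det = Y.det * Z.det) : IsUnit Z.det := by
  obtain ⟨d, hd, hXd⟩ := hX
  obtain ⟨e, he, hYe⟩ := hY
  have hp' : (p : ℤ) ≠ 0 := by exact_mod_cast hp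
  have : d = e * Z.det := by
    apply mul_left_cancel₀ hp'
    rw [← hXd, h, hYe, mul_assoc]
  rw [this] at hd
  exact isUnit_of_mul_isUnit_right hd

theorem card_rep_through_point_down {p : ℕ} [Fact p.Prime] {u : ℕ}
    {T : Fin u → Matrix (Fin 3) (Fin 3) ℚ} {S : Matrix (Fin 3) (Fin 3) ℚ}
    (hTint : ∀ i x, ∃ k : ℤ, qf (T i) x = k)
    (hTne : ∀ i j, i ≠ j → ¬ ZEquiv (T i) (T j))
    (hdet : ∀ i (X : Matrix (Fin 3) (Fin 3) ℤ),
      (intMap X)ᵀ * S * intMap X = (p : ℚ) • T i → ∃ d : ℤ, IsUnit d ∧ X.det = p * d)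
    (hdown : ∀ N : AddSubgroup (Fin 3 → ℤ), N.index = p →
      (∀ x ∈ N, ∃ k : ℤ, qf S x = (p : ℚ) * k) →
      ∀ Y : Matrix (Fin 3) (Fin 3) ℤ, (∀ x, x ∈ N ↔ ∃ c, x = Y.mulVec c) →
        ∃ i, ZEquiv (((p : ℚ))⁻¹ • ((intMap Y)ᵀ * S * intMap Y)) (T i))
    {x : Fin 3 → ℤ} {N : AddSubgroup (Fin 3 → ℤ)} (hNi : N.index = p) (hxN : x ∈ N)
    (hNS : ∀ y ∈ N, ∃ k : ℤ, qf S y = (p : ℚ) * k)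
    (hNX : ∀ X : Matrix (Fin 3) (Fin 3) ℤ, (∀ w, ∃ k : ℤ, qf S (X.mulVec w) = (p : ℚ) * k) →
        (∃ w, X.mulVec w = x) → ∀ w, X.mulVec w ∈ N) :
    ∃ i, Nat.card {X : {X : Matrix (Fin 3) (Fin 3) ℤ //
          (intMap X)ᵀ * S * intMap X = (p : ℚ) • T i} // ∃ w, X.1.mulVec w = x} = autNum (T i) ∧
      ∀ j, j ≠ i → ∀ X : {X : Matrix (Fin 3) (Fin 3) ℤ //
          (intMap X)ᵀ * S * intMap X = (p : ℚ) • T j}, ¬ ∃ w, X.1.mulVec w = x := by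
  have hp := (Fact.out : p.Prime).ne_zero
  have hpQ : (p : ℚ) ≠ 0 := by exact_mod_cast hp
  obtain ⟨Y, hY⟩ := exists_matrix_of_finiteIndex N (hNi.trans_ne hp)
  obtain ⟨i, U, hU, hUT⟩ := hdown N hNi hNS Y hY
  set X₀ := Y * U with hX₀
  have hX₀S : (intMap X₀)ᵀ * S * intMap X₀ = (p : ℚ) • T i := by
    rw [hX₀, congr_mul, ← hUT, Matrix.mul_smul, Matrix.smul_mul, smul_inv_smul₀ hpQ]
  have hX₀det := hdet i X₀ hX₀S
  have hX₀0 : X₀.det ≠ 0 := by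
    obtain ⟨d, hd, h⟩ := hX₀det
    rw [h]
    exact mul_ne_zero (by exact_mod_cast hp) hd.ne_zero
  have hX₀N : ∀ z ∈ N, ∃ c, z = X₀.mulVec c := by
    intro z hz
    obtain ⟨c, hc⟩ := (hY z).mp hz
    refine ⟨U⁻¹.mulVec c, ?_⟩
    rw [hX₀, Matrix.mulVec_mulVec, Matrix.mul_assoc, Matrix.mul_nonsing_inv _ hU,
      Matrix.mul_one, hc]
  have hfactor : ∀ j (X : Matrix (Fin 3) (Fin 3) ℤ),
      (intMap X)ᵀ * S * intMap X = (p : ℚ) • T j → (∃ w, X.mulVec w = x) →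
      ∃ Z : Matrix (Fin 3) (Fin 3) ℤ, X = X₀ * Z ∧ IsUnit Z.det ∧
        (intMap Z)ᵀ * T i * intMap Z = T j := by
    intro j X hX hxX
    obtain ⟨Z, rfl⟩ := exists_eq_mul_of_forall_mulVec (X := X) (Y := X₀) fun c => by
      refine hX₀N _ (hNX X (fun w => ?_) hxX c)
      obtain ⟨k, hk⟩ := hTint j w
      exact ⟨k, by rw [qf_mulVec, hX, qf_smul_matrix, hk]⟩
    refine ⟨Z, rfl, isUnit_det_of_mul hp (hdet j _ hX) hX₀det (Matrix.det_mul _ _), ?_⟩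
    rw [congr_mul, hX₀S, Matrix.mul_smul, Matrix.smul_mul] at hX
    exact smul_right_injective _ hpQ hX
  refine ⟨i, ?_, ?_⟩
  · refine (Nat.card_eq_of_bijective (fun Z : {Z : Matrix (Fin 3) (Fin 3) ℤ //
      IsUnit Z.det ∧ (intMap Z)ᵀ * T i * intMap Z = T i} =>
      (⟨⟨X₀ * Z.1, ?_⟩, ?_⟩ : {X : {X : Matrix (Fin 3) (Fin 3) ℤ //
          (intMap X)ᵀ * S * intMap X = (p : ℚ) • T i} // ∃ w, X.1.mulVec w = x})) ⟨?_, ?_⟩).symm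
    · rw [congr_mul, hX₀S, Matrix.mul_smul, Matrix.smul_mul, Z.2.2]
    · obtain ⟨c, hc⟩ := hX₀N x hxN
      refine ⟨Z.1⁻¹.mulVec c, ?_⟩
      rw [Matrix.mulVec_mulVec, Matrix.mul_assoc, Matrix.mul_nonsing_inv _ Z.2.1,
        Matrix.mul_one, hc]
    · intro Z Z' h
      exact Subtype.ext (mul_left_cancel_of_det_ne_zero hX₀0
        (congrArg Subtype.val (congrArg Subtype.val h)))
    · rintro ⟨⟨X, hX⟩, hxX⟩
      obtain ⟨Z, rfl, hZ⟩ := hfactor i X hX hxX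
      exact ⟨⟨Z, hZ⟩, rfl⟩
  · rintro j hj ⟨X, hX⟩ hxX
    obtain ⟨Z, -, hZ⟩ := hfactor j X hX hxX
    exact hTne i j hj.symm ⟨Z, hZ⟩

theorem exists_line_lattice {p : ℕ} [Fact p.Prime] {x : Fin 3 → ℤ}
    (hx : ¬ ∃ w : Fin 3 → ℤ, x = (p : ℤ) • w) :
    ∃ M : AddSubgroup (Fin 3 → ℤ), Nonempty (((Fin 3 → ℤ) ⧸ M) ≃+ (ZMod p × ZMod p)) ∧
      M.index ≠ 0 ∧ ∀ z, z ∈ M ↔ ∃ (a : ℤ) (w : Fin 3 → ℤ), z = a • x + (p : ℤ) • w := by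
  let red : (Fin 3 → ℤ) →+ (Fin 3 → ZMod p) := (Int.castAddHom (ZMod p)).compLeft (Fin 3)
  have hred : ∀ z, red z = 0 ↔ ∃ w : Fin 3 → ℤ, z = (p : ℤ) • w := by
    intro z
    constructor
    · intro h
      have h' : ∀ i, (p : ℤ) ∣ z i := fun i =>
        (ZMod.intCast_zmod_eq_zero_iff_dvd _ _).mp (congrFun h i)
      choose w hw using h'
      exact ⟨w, funext hw⟩
    · rintro ⟨w, rfl⟩
      ext i
      change (((p : ℤ) * w i : ℤ) : ZMod p) = 0
      simp
  have hsurj : Function.Surjective red := fun y => by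
    choose w hw using fun i => ZMod.intCast_surjective (y i)
    exact ⟨w, funext hw⟩
  have hx0 : red x ≠ 0 := fun h => hx ((hred x).mp h)
  let K := Submodule.span (ZMod p) {red x}
  have hfin : Module.finrank (ZMod p) ((Fin 3 → ZMod p) ⧸ K)
      = Module.finrank (ZMod p) (ZMod p × ZMod p) := by
    have h1 := K.finrank_quotient_add_finrank
    rw [finrank_span_singleton hx0, Module.finrank_fin_fun] at h1
    rw [Module.finrank_prod, Module.finrank_self]
    omega
  let e := LinearEquiv.ofFinrankEq _ _ hfin
  let g : (Fin 3 → ℤ) →+ ZMod p × ZMod p :=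
    ((e.toLinearMap.comp K.mkQ).toAddMonoidHom).comp red
  have hg : Function.Surjective g :=
    (e.surjective.comp K.mkQ_surjective).comp hsurj
  have hquot := QuotientAddGroup.quotientKerEquivOfSurjective g hg
  refine ⟨g.ker, ⟨hquot⟩, ?_, fun z => ?_⟩
  · rw [AddSubgroup.index_ker, AddMonoidHom.range_eq_top.mpr hg, AddSubgroup.card_top]
    exact Nat.card_pos.ne'
  · have h1 : z ∈ g.ker ↔ red z ∈ K := by
      change e (K.mkQ (red z)) = 0 ↔ _
      rw [LinearEquiv.map_eq_zero_iff, Submodule.mkQ_apply, Submodule.Quotient.mk_eq_zero]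
    rw [h1, Submodule.mem_span_singleton]
    constructor
    · rintro ⟨a, ha⟩
      obtain ⟨a, rfl⟩ := ZMod.intCast_surjective a
      have h2 : red (z - a • x) = 0 := by
        rw [map_sub, map_zsmul, ← ha, sub_eq_zero]
        exact Int.cast_smul_eq_zsmul _ _ _
      obtain ⟨w, hw⟩ := (hred _).mp h2
      exact ⟨a, w, by rw [← hw]; abel⟩
    · rintro ⟨a, w, rfl⟩
      refine ⟨(a : ZMod p), ?_⟩
      rw [map_add, map_zsmul, (hred _).mpr ⟨w, rfl⟩, add_zero]
      exact Int.cast_smul_eq_zsmul _ _ _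

/-- If `p ∥ T(x)` then `T` takes values in `pℤ` on `ℤx + pℤ³`, which is not the Watson lattice. -/
theorem exists_isotropic_line_lattice {p : ℕ} [Fact p.Prime] {T : Matrix (Fin 3) (Fin 3) ℚ}
    (hTint : ∀ x, ∃ k : ℤ, qf T x = k)
    {φ : (Fin 3 → ℤ) →+ (Fin 3 → ZMod p)} (hφ : Function.Surjective φ)
    (hφT : ∀ (x : Fin 3 → ℤ) (n : ℤ), qf T x = n →
        ((p : ℤ) ∣ n ↔ φ x 0 * φ x 1 = 0) ∧
        (φ x 0 = 0 → φ x 1 = 0 → (p : ℤ) ^ 2 ∣ n))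
    {x : Fin 3 → ℤ} {n : ℤ} (hx : qf T x = ((p * n : ℤ) : ℚ)) (hn : ¬ (p : ℤ) ∣ n) :
    ∃ M : AddSubgroup (Fin 3 → ℤ), Nonempty (((Fin 3 → ℤ) ⧸ M) ≃+ (ZMod p × ZMod p)) ∧
      M.index ≠ 0 ∧ (∀ z, z ∈ M ↔ ∃ (a : ℤ) (w : Fin 3 → ℤ), z = a • x + (p : ℤ) • w) ∧
      (∀ z ∈ M, ∃ k : ℤ, qf T z = (p : ℚ) * k) ∧ ¬ (∀ z, z ∈ M ↔ z ∈ LamSet p T) := by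
  have hp0 : (p : ℤ) ≠ 0 := by exact_mod_cast (Fact.out : p.Prime).ne_zero
  obtain ⟨h1, h2⟩ := hφT x _ hx
  have hiso : φ x 0 * φ x 1 = 0 := h1.mp (dvd_mul_right _ _)
  have hnot : ¬ (φ x 0 = 0 ∧ φ x 1 = 0) := fun h => by
    have := h2 h.1 h.2
    rw [pow_two] at this
    exact hn (Int.dvd_of_mul_dvd_mul_left hp0 this)
  have hφp : ∀ w i, φ ((p : ℤ) • w) i = 0 := fun w i => by
    rw [map_zsmul, Pi.smul_apply, zsmul_eq_mul]
    simp
  obtain ⟨M, hq, hi, hM⟩ := exists_line_lattice (p := p) (x := x) (by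
    rintro ⟨w, rfl⟩
    exact hnot ⟨hφp w 0, hφp w 1⟩)
  refine ⟨M, hq, hi, hM, ?_, fun hLam => hnot ?_⟩
  · intro z hz
    obtain ⟨a, w, rfl⟩ := (hM z).mp hz
    obtain ⟨k, hk⟩ := hTint (a • x + (p : ℤ) • w)
    have h3 : (p : ℤ) ∣ k := by
      rw [(hφT _ k hk).1, map_add, Pi.add_apply, Pi.add_apply, hφp, hφp, map_zsmul,
        Pi.smul_apply, Pi.smul_apply, add_zero, add_zero, smul_mul_smul_comm, hiso, smul_zero]
    obtain ⟨l, rfl⟩ := h3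
    exact ⟨l, by rw [hk]; push_cast; rfl⟩
  · have hxL : x ∈ LamSet p T := (hLam x).mp ((hM x).mpr ⟨1, 0, by simp⟩)
    have hiff : ∀ z, φ z 0 * φ z 1 = 0 → φ (x + z) 0 * φ (x + z) 1 = 0 := by
      intro z hz
      obtain ⟨k, hk⟩ := hxL z
      obtain ⟨l, hl⟩ := hTint z
      obtain ⟨j, hj⟩ := hTint (x + z)
      rw [← (hφT _ _ hj).1]
      rw [← (hφT _ _ hl).1] at hz
      rw [hj, hl] at hk
      have : j = l + p * k := by
        have : (j : ℚ) = ((l + p * k : ℤ) : ℚ) := by push_cast; linarith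
        exact_mod_cast this
      rw [this]
      exact dvd_add hz (dvd_mul_right _ _)
    have hcase : ∀ z, φ z 0 * φ z 1 = 0 → φ x 0 * φ z 1 + φ z 0 * φ x 1 = 0 := by
      intro z hz
      have := hiff z hz
      rw [map_add, Pi.add_apply, Pi.add_apply] at this
      linear_combination this - hiso - hz
    constructor
    · obtain ⟨z, hz⟩ := hφ (Pi.single 1 1)
      simpa [hz] using hcase z
    · obtain ⟨z, hz⟩ := hφ (Pi.single 0 1)
      simpa [hz] using hcase z

theorem card_rep_through_point_up {p : ℕ} [Fact p.Prime] {v : ℕ}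
    {T : Matrix (Fin 3) (Fin 3) ℚ} {S : Fin v → Matrix (Fin 3) (Fin 3) ℚ}
    (hSne : ∀ i j, i ≠ j → ¬ ZEquiv (S i) (S j))
    (hdet : ∀ j (X : Matrix (Fin 3) (Fin 3) ℤ),
      (intMap X)ᵀ * S j * intMap X = (p : ℚ) • T → ∃ d : ℤ, IsUnit d ∧ X.det = p * d)
    {x : Fin 3 → ℤ} {M : AddSubgroup (Fin 3 → ℤ)} (hMi : M.index ≠ 0)
    (hM : ∀ z, z ∈ M ↔ ∃ (a : ℤ) (w : Fin 3 → ℤ), z = a • x + (p : ℤ) • w)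
    (hup : ∀ Y : Matrix (Fin 3) (Fin 3) ℤ, (∀ x, x ∈ M ↔ ∃ c, x = Y.mulVec c) →
        ∃ j, ZEquiv ((intMap Y)ᵀ * T * intMap Y) ((p : ℚ) • S j)) :
    ∃ j, Nat.card {X : {X : Matrix (Fin 3) (Fin 3) ℤ //
          (intMap X)ᵀ * S j * intMap X = (p : ℚ) • T} //
            ∃ y : Fin 3 → ℤ, X.1.mulVec x = (p : ℤ) • y} = autNum (S j) ∧
      ∀ i, i ≠ j → ∀ X : {X : Matrix (Fin 3) (Fin 3) ℤ //
          (intMap X)ᵀ * S i * intMap X = (p : ℚ) • T},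
            ¬ ∃ y : Fin 3 → ℤ, X.1.mulVec x = (p : ℤ) • y := by
  have hp := (Fact.out : p.Prime).ne_zero
  have hpQ : (p : ℚ) ≠ 0 := by exact_mod_cast hp
  have hpZ : (p : ℤ) ≠ 0 := by exact_mod_cast hp
  obtain ⟨Y, hY⟩ := exists_matrix_of_finiteIndex M hMi
  obtain ⟨j, U, hU, hUS⟩ := hup Y hY
  set Y₀ := Y * U with hY₀
  have hY₀T : (intMap Y₀)ᵀ * T * intMap Y₀ = (p : ℚ) • S j := by
    rw [hY₀, congr_mul, hUS]
  have hY₀M : ∀ z, z ∈ M ↔ ∃ c, z = Y₀.mulVec c := by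
    intro z
    rw [hY]
    constructor
    · rintro ⟨c, rfl⟩
      refine ⟨U⁻¹.mulVec c, ?_⟩
      rw [hY₀, Matrix.mulVec_mulVec, Matrix.mul_assoc, Matrix.mul_nonsing_inv _ hU,
        Matrix.mul_one]
    · rintro ⟨c, rfl⟩
      exact ⟨U.mulVec c, by rw [Matrix.mulVec_mulVec]⟩
  obtain ⟨X₀, hYX⟩ := exists_eq_mul_of_forall_mulVec (X := (p : ℤ) • 1) (Y := Y₀) fun c =>
    (hY₀M _).mp ((hM _).mpr ⟨0, c, by simp⟩)
  have hXY : X₀ * Y₀ = (p : ℤ) • 1 := by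
    have hY0 : Y₀.det ≠ 0 := fun h0 => by
      have := congrArg Matrix.det hYX
      rw [Matrix.det_mul, h0, zero_mul, Matrix.det_smul, Matrix.det_one, mul_one] at this
      exact pow_ne_zero _ hpZ this
    apply mul_left_cancel_of_det_ne_zero hY0
    rw [← Matrix.mul_assoc, ← hYX, Matrix.smul_mul, Matrix.one_mul, Matrix.mul_smul,
      Matrix.mul_one]
  have hX₀S : (intMap X₀)ᵀ * S j * intMap X₀ = (p : ℚ) • T := by
    have h := congr_mul T Y₀ X₀
    rw [← hYX, hY₀T, intMap_smul, intMap_one] at h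
    apply smul_right_injective _ hpQ
    simpa [Matrix.smul_mul, Matrix.mul_smul, smul_smul] using h.symm
  have hX₀det := hdet j X₀ hX₀S
  have hX₀0 : X₀.det ≠ 0 := by
    obtain ⟨d, hd, h⟩ := hX₀det
    rw [h]
    exact mul_ne_zero hpZ hd.ne_zero
  obtain ⟨y₀, hy₀⟩ := (hY₀M x).mp ((hM x).mpr ⟨1, 0, by simp⟩)
  have hX₀x : X₀.mulVec x = (p : ℤ) • y₀ := by
    rw [hy₀, Matrix.mulVec_mulVec, hXY, Matrix.smul_mulVec, Matrix.one_mulVec]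
  have hfactor : ∀ i (X : Matrix (Fin 3) (Fin 3) ℤ),
      (intMap X)ᵀ * S i * intMap X = (p : ℚ) • T →
      (∃ y : Fin 3 → ℤ, X.mulVec x = (p : ℤ) • y) →
      ∃ Z : Matrix (Fin 3) (Fin 3) ℤ, X = Z * X₀ ∧ IsUnit Z.det ∧
        (intMap Z)ᵀ * S i * intMap Z = S j := by
    rintro i X hX ⟨y, hy⟩
    obtain ⟨Z, hZ⟩ := exists_eq_mul_of_forall_mulVec (X := X * Y₀) (Y := (p : ℤ) • 1)
      fun c => by
        obtain ⟨a, w, haw⟩ := (hM (Y₀.mulVec c)).mp ((hY₀M _).mpr ⟨c, rfl⟩)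
        refine ⟨a • y + X.mulVec w, ?_⟩
        rw [← Matrix.mulVec_mulVec, haw, Matrix.mulVec_add, Matrix.mulVec_smul,
          Matrix.mulVec_smul, hy, Matrix.smul_mulVec, Matrix.one_mulVec, smul_add,
          smul_comm]
    have hXZ : X = Z * X₀ := by
      have h := congrArg (· * X₀) hZ
      simp only [Matrix.mul_assoc, ← hYX, Matrix.smul_mul, Matrix.mul_smul, Matrix.one_mul,
        Matrix.mul_one] at h
      exact smul_right_injective _ hpZ h
    refine ⟨Z, hXZ, isUnit_det_of_mul hp (hdet i _ hX) hX₀det ?_, ?_⟩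
    · rw [hXZ, Matrix.det_mul, mul_comm]
    · apply congr_injective hX₀0
      rw [← congr_mul, ← hXZ, hX, hX₀S]
  refine ⟨j, ?_, ?_⟩
  · refine (Nat.card_eq_of_bijective (fun Z : {Z : Matrix (Fin 3) (Fin 3) ℤ //
      IsUnit Z.det ∧ (intMap Z)ᵀ * S j * intMap Z = S j} =>
      (⟨⟨Z.1 * X₀, ?_⟩, ?_⟩ : {X : {X : Matrix (Fin 3) (Fin 3) ℤ //
          (intMap X)ᵀ * S j * intMap X = (p : ℚ) • T} //
            ∃ y : Fin 3 → ℤ, X.1.mulVec x = (p : ℤ) • y})) ⟨?_, ?_⟩).symm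
    · rw [congr_mul, Z.2.2, hX₀S]
    · exact ⟨Z.1.mulVec y₀, by rw [← Matrix.mulVec_mulVec, hX₀x, Matrix.mulVec_smul]⟩
    · intro Z Z' h
      exact Subtype.ext (mul_right_cancel_of_det_ne_zero hX₀0
        (congrArg Subtype.val (congrArg Subtype.val h)))
    · rintro ⟨⟨X, hX⟩, hxX⟩
      obtain ⟨Z, rfl, hZ⟩ := hfactor j X hX hxX
      exact ⟨⟨Z, hZ⟩, rfl⟩
  · rintro i hi ⟨X, hX⟩ hxX
    obtain ⟨Z, -, hZ⟩ := hfactor i X hX hxX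
    exact hSne i j hi ⟨Z, hZ⟩

theorem card_points_down {p : ℕ} {S T : Matrix (Fin 3) (Fin 3) ℚ} (hp : p ≠ 0) (n : ℤ)
    {X : Matrix (Fin 3) (Fin 3) ℤ} (hX : (intMap X)ᵀ * S * intMap X = (p : ℚ) • T)
    (hX0 : X.det ≠ 0) :
    Nat.card {x : {x : Fin 3 → ℤ // qf S x = ((p * n : ℤ) : ℚ)} // ∃ w, X.mulVec w = x.1}
      = rEval T n := by
  have hpQ : (p : ℚ) ≠ 0 := by exact_mod_cast hp
  have hq : ∀ w, qf S (X.mulVec w) = ((p * n : ℤ) : ℚ) ↔ qf T w = n := fun w => by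
    rw [qf_mulVec, hX, qf_smul_matrix, Int.cast_mul, Int.cast_natCast, mul_right_inj' hpQ]
  refine (Nat.card_eq_of_bijective (fun w : {w : Fin 3 → ℤ // qf T w = (n : ℚ)} =>
    (⟨⟨X.mulVec w.1, (hq _).mpr w.2⟩, w.1, rfl⟩ :
      {x : {x : Fin 3 → ℤ // qf S x = ((p * n : ℤ) : ℚ)} // ∃ w, X.mulVec w = x.1}))
    ⟨?_, ?_⟩).symm
  · intro w w' h
    exact Subtype.ext (Matrix.mulVec_injective_of_det_ne_zero hX0
      (congrArg Subtype.val (congrArg Subtype.val h)))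
  · rintro ⟨⟨x, hx⟩, w, hw⟩
    obtain rfl : X.mulVec w = x := hw
    exact ⟨⟨w, (hq w).mp hx⟩, rfl⟩

theorem card_points_up {p : ℕ} {S T : Matrix (Fin 3) (Fin 3) ℚ} (hp : p ≠ 0) (n : ℤ)
    {X : Matrix (Fin 3) (Fin 3) ℤ} (hX : (intMap X)ᵀ * S * intMap X = (p : ℚ) • T)
    (hXd : ∃ d : ℤ, IsUnit d ∧ X.det = p * d) :
    Nat.card {x : {x : Fin 3 → ℤ // qf T x = ((p * n : ℤ) : ℚ)} //
        ∃ y : Fin 3 → ℤ, X.mulVec x.1 = (p : ℤ) • y}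
      = rEval S n := by
  have hpQ : (p : ℚ) ≠ 0 := by exact_mod_cast hp
  have hpZ : (p : ℤ) ≠ 0 := by exact_mod_cast hp
  obtain ⟨d, hd, hdet⟩ := hXd
  have hX0 : X.det ≠ 0 := by
    rw [hdet]
    exact mul_ne_zero hpZ hd.ne_zero
  have hdd : d * d = 1 := by
    rcases Int.isUnit_iff.mp hd with rfl | rfl <;> rfl
  have hadj : ∀ y, X.mulVec ((d • X.adjugate).mulVec y) = (p : ℤ) • y := fun y => by
    rw [Matrix.mulVec_mulVec, Matrix.mul_smul, Matrix.mul_adjugate, smul_smul, hdet,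
      Matrix.smul_mulVec, Matrix.one_mulVec, mul_left_comm, hdd, mul_one]
  have hq : ∀ x y : Fin 3 → ℤ, X.mulVec x = (p : ℤ) • y →
      (qf T x = ((p * n : ℤ) : ℚ) ↔ qf S y = n) := fun x y hxy => by
    have h := qf_mulVec S X x
    rw [hX, qf_smul_matrix, hxy, qf_smul, Int.cast_natCast, pow_two, mul_assoc,
      mul_right_inj' hpQ] at h
    rw [← h, Int.cast_mul, Int.cast_natCast, mul_right_inj' hpQ]
  refine (Nat.card_eq_of_bijective (fun y : {y : Fin 3 → ℤ // qf S y = (n : ℚ)} =>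
    (⟨⟨(d • X.adjugate).mulVec y.1, (hq _ _ (hadj y.1)).mpr y.2⟩, y.1, hadj y.1⟩ :
      {x : {x : Fin 3 → ℤ // qf T x = ((p * n : ℤ) : ℚ)} //
        ∃ y : Fin 3 → ℤ, X.mulVec x.1 = (p : ℤ) • y}))
    ⟨?_, ?_⟩).symm
  · intro y y' h
    have h1 : (d • X.adjugate).mulVec y.1 = (d • X.adjugate).mulVec y'.1 :=
      congrArg Subtype.val (congrArg Subtype.val h)
    have h2 := congrArg X.mulVec h1
    rw [hadj, hadj] at h2
    exact Subtype.ext (smul_right_injective _ hpZ h2)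
  · rintro ⟨⟨x, hx⟩, y, hy⟩
    refine ⟨⟨y, (hq x y hy).mp hx⟩, Subtype.ext (Subtype.ext ?_)⟩
    apply Matrix.mulVec_injective_of_det_ne_zero hX0
    exact (hadj y).trans hy.symm

theorem isUnit_of_rank_eq {K : Type*} [Field K] {n : ℕ} {A : Matrix (Fin n) (Fin n) K}
    (h : A.rank = n) : IsUnit A := by
  rw [← Matrix.mulVec_surjective_iff_isUnit]
  change Function.Surjective A.mulVecLin
  rw [← LinearMap.range_eq_top]
  apply Submodule.eq_top_of_finrank_eq
  rw [Module.finrank_fin_fun]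
  exact h

/-- Theorem 4.8 of the paper (parts for `p ∤ n`): for `m ≥ 3`, `T₁,…,T_u` in
`𝒢_{L,p}(m)`, `S₁,…,S_v` in `𝒢_{L,p}(m+1)`, with closure conditions (i) and (ii), for
every positive `n` not divisible by `p`:
(a) `r(pn,T_i) = ∑_j (r(T_i^p,S_j)/o(S_j)) r(n,S_j)`; and
(b) if `rank 𝓝 = u` then `R(n,spn(T)) = (𝓝𝓝ᵗ)⁻¹ 𝓝 · R(pn,spn(S))`. -/
theorem stmt_19 (p : ℕ) [Fact p.Prime] (ε : ℤ_[p]ˣ) (m : ℕ) (hm : 3 ≤ m)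
    (u v : ℕ) (hu : 0 < u)
    (T : Fin u → Matrix (Fin 3) (Fin 3) ℚ) (S : Fin v → Matrix (Fin 3) (Fin 3) ℚ)
    (hT : ∀ i, PosDef3 (T i) ∧ HalfIntegral (T i))
    (hTne : ∀ i j, i ≠ j → ¬ ZEquiv (T i) (T j))
    (hTloc : ∀ i j, ∀ q : ℕ, ∀ hq : q.Prime, @ZqEquiv q ⟨hq⟩ (T i) (T j))
    (hTp : ∀ i, ZpEquivTo p (T i) (Hblock p ((p : ℚ_[p]) ^ m * ((ε : ℤ_[p]) : ℚ_[p]))))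
    (hS : ∀ j, PosDef3 (S j) ∧ HalfIntegral (S j))
    (hSne : ∀ i j, i ≠ j → ¬ ZEquiv (S i) (S j))
    (hSp : ∀ j, ZpEquivTo p (S j)
      (Hblock p ((p : ℚ_[p]) ^ (m + 1) * ((ε : ℤ_[p]) : ℚ_[p]))))
    (hSloc : ∀ j, ∀ q : ℕ, ∀ hq : q.Prime, q ≠ p →
      @ZqEquiv q ⟨hq⟩ (S j) ((p : ℚ) • T ⟨0, hu⟩))
    (hdown : ∀ j, ∀ N : AddSubgroup (Fin 3 → ℤ), N.index = p →
      (∀ x ∈ N, ∃ k : ℤ, qf (S j) x = (p : ℚ) * k) →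
      ∀ Y : Matrix (Fin 3) (Fin 3) ℤ, (∀ x, x ∈ N ↔ ∃ c, x = Y.mulVec c) →
        ∃ i, ZEquiv (((p : ℚ))⁻¹ • ((intMap Y)ᵀ * S j * intMap Y)) (T i))
    (hup : ∀ i, ∀ M : AddSubgroup (Fin 3 → ℤ),
      Nonempty (((Fin 3 → ℤ) ⧸ M) ≃+ (ZMod p × ZMod p)) →
      (∀ x ∈ M, ∃ k : ℤ, qf (T i) x = (p : ℚ) * k) →
      ¬ (∀ x, x ∈ M ↔ x ∈ LamSet p (T i)) →
      ∀ Y : Matrix (Fin 3) (Fin 3) ℤ, (∀ x, x ∈ M ↔ ∃ c, x = Y.mulVec c) →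
        ∃ j, ZEquiv ((intMap Y)ᵀ * T i * intMap Y) ((p : ℚ) • S j))
    (NN : Matrix (Fin u) (Fin v) ℚ)
    (hNN : NN = Matrix.of fun i j =>
      (repNum ((p : ℚ) • T i) (S j) : ℚ) / (autNum (S j) : ℚ)) :
    ∀ n : ℤ, 0 < n → ¬ (p : ℤ) ∣ n →
      (∀ i, (rEval (T i) ((p : ℤ) * n) : ℚ)
        = ∑ j, ((repNum ((p : ℚ) • T i) (S j) : ℚ) / (autNum (S j) : ℚ))
            * (rEval (S j) n : ℚ)) ∧
      (NN.rank = u →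
        (fun i => (rEval (T i) n : ℚ) / (autNum (T i) : ℚ))
          = ((NN * NNᵀ)⁻¹ * NN).mulVec
              (fun j => (rEval (S j) ((p : ℤ) * n) : ℚ) / (autNum (S j) : ℚ))) := by
  have hpp : p.Prime := Fact.out
  have hTint := fun i => HalfIntegral.exists_qf_eq (hT i).1.1 (hT i).2
  have hSint := fun j => HalfIntegral.exists_qf_eq (hS j).1.1 (hS j).2
  have hdet : ∀ i j (X : Matrix (Fin 3) (Fin 3) ℤ),
      (intMap X)ᵀ * S j * intMap X = (p : ℚ) • T i → ∃ d : ℤ, IsUnit d ∧ X.det = p * d := by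
    intro i j X hX
    refine det_eq_of_rep hpp (hS j).1.det_ne_zero (fun q hq => ?_) hX
    by_cases hqp : q = p
    · subst hqp
      rw [(hSp j).norm_det, Rat.cast_mul, norm_mul, (hTp i).norm_det, ← norm_mul]
      congr 1
      simp [Hblock, Matrix.det_fin_three]
      ring
    · have hT0 := ZqEquiv.norm_det (hTloc ⟨0, hu⟩ i q hq.out)
      rw [ZqEquiv.norm_det (hSloc j q hq.out hqp), Matrix.det_smul, Fintype.card_fin,
        Rat.cast_mul, Rat.cast_mul, norm_mul, norm_mul, hT0]
      have hpn : ‖((p : ℚ) : ℚ_[q])‖ = 1 := by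
        rw [Rat.cast_natCast, Padic.norm_natCast_eq_one_iff]
        exact (Nat.coprime_primes hq.out hpp).mpr hqp
      rw [Rat.cast_pow, norm_pow, hpn, one_pow]
  have hfinT : ∀ i (k : ℚ), Finite {x : Fin 3 → ℤ // qf (T i) x = k} :=
    fun i k => ((hT i).1.finite_qf_eq k).to_subtype
  have hfinS : ∀ j (k : ℚ), Finite {x : Fin 3 → ℤ // qf (S j) x = k} :=
    fun j k => ((hS j).1.finite_qf_eq k).to_subtype
  have hfinR : ∀ i j, Finite {X : Matrix (Fin 3) (Fin 3) ℤ //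
      (intMap X)ᵀ * S j * intMap X = (p : ℚ) • T i} :=
    fun i j => ((hS j).1.finite_rep _).to_subtype
  intro n _ hpn
  have hup' : ∀ i, (rEval (T i) ((p : ℤ) * n) : ℚ)
      = ∑ j, ((repNum ((p : ℚ) • T i) (S j) : ℚ) / (autNum (S j) : ℚ))
          * (rEval (S j) n : ℚ) := by
    intro i
    refine card_eq_sum_of_fibers (α := {x : Fin 3 → ℤ // qf (T i) x = ((p * n : ℤ) : ℚ)})
      (R := fun j => {X : Matrix (Fin 3) (Fin 3) ℤ //
        (intMap X)ᵀ * S j * intMap X = (p : ℚ) • T i})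
      (V := fun j => {y : Fin 3 → ℤ // qf (S j) y = (n : ℚ)})
      (fun j => autNum (S j)) (fun j => (hS j).1.autNum_ne_zero)
      (fun j X x => ∃ y : Fin 3 → ℤ, X.1.mulVec x.1 = (p : ℤ) • y) ?_ ?_
    · intro j X
      exact card_points_up hpp.ne_zero n X.2 (hdet i j X.1 X.2)
    · rintro ⟨x, hx⟩
      obtain ⟨φ, hφ, hφT⟩ := exists_reduction (by omega) ε (hTp i)
      obtain ⟨M, hMq, hMi, hM, hMT, hML⟩ :=
        exists_isotropic_line_lattice (hTint i) hφ hφT hx hpn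
      exact card_rep_through_point_up hSne (hdet i) hMi hM (hup i M hMq hMT hML)
  have hdown' : ∀ j, (rEval (S j) ((p : ℤ) * n) : ℚ)
      = ∑ i, ((repNum ((p : ℚ) • T i) (S j) : ℚ) / (autNum (T i) : ℚ))
          * (rEval (T i) n : ℚ) := by
    intro j
    refine card_eq_sum_of_fibers (α := {x : Fin 3 → ℤ // qf (S j) x = ((p * n : ℤ) : ℚ)})
      (R := fun i => {X : Matrix (Fin 3) (Fin 3) ℤ //
        (intMap X)ᵀ * S j * intMap X = (p : ℚ) • T i})
      (V := fun i => {y : Fin 3 → ℤ // qf (T i) y = (n : ℚ)})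
      (fun i => autNum (T i)) (fun i => (hT i).1.autNum_ne_zero)
      (fun i X x => ∃ w, X.1.mulVec w = x.1) ?_ ?_
    · intro i X
      refine card_points_down hpp.ne_zero n X.2 ?_
      obtain ⟨d, hd, h⟩ := hdet i j X.1 X.2
      rw [h]
      exact mul_ne_zero (by exact_mod_cast hpp.ne_zero) hd.ne_zero
    · rintro ⟨x, hx⟩
      obtain ⟨φ, hφ, hφS⟩ := exists_reduction (by omega) ε (hSp j)
      obtain ⟨N, hNi, hxN, hNS, hNX⟩ :=
        exists_index_sublattice (hSint j) hφ hφS hx hpn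
      exact card_rep_through_point_down hTint hTne (fun i => hdet i j) (hdown j) hNi hxN hNS hNX
  refine ⟨hup', fun hrank => ?_⟩
  have hunit : IsUnit (NN * NNᵀ).det := by
    rw [← Matrix.isUnit_iff_isUnit_det]
    exact isUnit_of_rank_eq ((Matrix.rank_self_mul_transpose NN).trans hrank)
  have hs : (fun j => (rEval (S j) ((p : ℤ) * n) : ℚ) / (autNum (S j) : ℚ))
      = NNᵀ.mulVec fun i => (rEval (T i) n : ℚ) / (autNum (T i) : ℚ) := by
    funext j
    rw [hdown' j, hNN, Finset.sum_div]
    simp only [Matrix.mulVec, dotProduct, Matrix.transpose_apply, Matrix.of_apply]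
    refine Finset.sum_congr rfl fun i _ => ?_
    ring
  rw [hs, Matrix.mulVec_mulVec, Matrix.mul_assoc, Matrix.nonsing_inv_mul _ hunit,
    Matrix.one_mulVec]
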